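/- arXiv:2506.02879 — 3 statements merged into one kernel-verified Lean document; each statement's English description precedes it below -/
import Mathlib

section
/- Let n ≥ p ≥ 1 and λ > 0. For every X ∈ ℝ^{n×p} and every g ∈ ℝ^{n×p}, the Frobenius inner product ⟨skew(g Xᵀ)X, λ X(XᵀX − I_p)⟩ equals 0; i.e., the relative-gradient part skew(g Xᵀ)X of the landing direction is always orthogonal to the penalty gradient ∇N(X) = X(XᵀX − I_p), regardless of the gradient estimate g. -/
open Matrix Finset

noncomputable section

/-- Frobenius inner product `⟨A, B⟩ = Tr (Aᵀ * B)`. -/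
def finner {n p : ℕ} (A B : Matrix (Fin n) (Fin p) ℝ) : ℝ :=
  (Aᵀ * B).trace

/-- Frobenius norm `‖A‖_F = √(Tr (Aᵀ * A))`. -/
def fnorm {n p : ℕ} (A : Matrix (Fin n) (Fin p) ℝ) : ℝ :=
  Real.sqrt ((Aᵀ * A).trace)

/-- Skew-symmetric part `skew M = (M - Mᵀ)/2`. -/
def skewPart {m : ℕ} (M : Matrix (Fin m) (Fin m) ℝ) : Matrix (Fin m) (Fin m) ℝ :=
  (1 / 2 : ℝ) • (M - Mᵀ)

/-- Symmetric part `sym M = (M + Mᵀ)/2`. -/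
def symPart {m : ℕ} (M : Matrix (Fin m) (Fin m) ℝ) : Matrix (Fin m) (Fin m) ℝ :=
  (1 / 2 : ℝ) • (M + Mᵀ)

/-- Penalty function `N(X) = ‖XᵀX - I‖_F² / 4`. -/
def penaltyN {n p : ℕ} (X : Matrix (Fin n) (Fin p) ℝ) : ℝ :=
  (1 / 4 : ℝ) * fnorm (Xᵀ * X - 1) ^ 2

/-- Landing direction `Λ̃(X; g) = skew(g Xᵀ) X + λ X (XᵀX - I)` with gradient estimate `g`. -/
def landingDir {n p : ℕ} (lam : ℝ) (X g : Matrix (Fin n) (Fin p) ℝ) :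
    Matrix (Fin n) (Fin p) ℝ :=
  skewPart (g * Xᵀ) * X + lam • (X * (Xᵀ * X - 1))

theorem transpose_skewPart {m : ℕ} (M : Matrix (Fin m) (Fin m) ℝ) :
    (skewPart M)ᵀ = -skewPart M := by
  rw [skewPart, Matrix.transpose_smul, Matrix.transpose_sub, Matrix.transpose_transpose,
    ← smul_neg, neg_sub]

theorem trace_mul_eq_zero_of_skew_of_symm {m : ℕ} {K S : Matrix (Fin m) (Fin m) ℝ}
    (hK : Kᵀ = -K) (hS : S.IsSymm) : (K * S).trace = 0 := by
  have h : (K * S).trace = -(K * S).trace := by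
    conv_lhs => rw [← Matrix.trace_transpose, Matrix.transpose_mul, hS.eq, hK, Matrix.mul_neg,
      Matrix.trace_neg, Matrix.trace_mul_comm]
  linarith

/-- the relative-gradient part `skew(g Xᵀ) X` of the landing direction is
Frobenius-orthogonal to the penalty gradient `λ X (XᵀX - I)`, for every `X` and every
gradient estimate `g`. -/
theorem orthogonality_of_landing_parts {n p : ℕ} (hp : 1 ≤ p) (hpn : p ≤ n)
    (lam : ℝ) (hlam : 0 < lam) (X g : Matrix (Fin n) (Fin p) ℝ) :
    finner (skewPart (g * Xᵀ) * X) (lam • (X * (Xᵀ * X - 1))) = 0 := by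
  have hS : (X * (Xᵀ * X - 1) * Xᵀ).IsSymm := by
    simp [Matrix.IsSymm, Matrix.transpose_mul, Matrix.mul_assoc]
  have h := trace_mul_eq_zero_of_skew_of_symm (transpose_skewPart (g * Xᵀ)) hS
  rw [finner, Matrix.mul_smul, Matrix.trace_smul, Matrix.transpose_mul, Matrix.mul_assoc,
    Matrix.trace_mul_comm, Matrix.mul_assoc, transpose_skewPart, Matrix.neg_mul,
    Matrix.trace_neg, h, neg_zero, smul_zero]
end
end

section
/- Let ε ∈ (0, 3/4) and X ∈ St(p,n)^ε. Then for every g ∈ ℝ^{n×p}, ‖skew(g Xᵀ)X‖_F ≤ (1+ε)‖g‖_F. -/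
open Matrix Finset

noncomputable section

section Frobenius

open scoped Matrix.Norms.Frobenius

lemma trace_transpose_mul_eq_sum {n p : ℕ} (A B : Matrix (Fin n) (Fin p) ℝ) :
    (Aᵀ * B).trace = ∑ x : Fin n × Fin p, A x.1 x.2 * B x.1 x.2 := by
  rw [Fintype.sum_prod_type, Finset.sum_comm]
  simp [Matrix.trace, Matrix.mul_apply]

lemma fnorm_eq_norm {n p : ℕ} (A : Matrix (Fin n) (Fin p) ℝ) : fnorm A = ‖A‖ := by
  rw [fnorm, trace_transpose_mul_eq_sum, Matrix.frobenius_norm_def, Real.sqrt_eq_rpow,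
    Fintype.sum_prod_type]
  simp [pow_two]

lemma trace_transpose_mul_self {n p : ℕ} (A : Matrix (Fin n) (Fin p) ℝ) :
    (Aᵀ * A).trace = ‖A‖ ^ 2 := by
  rw [← fnorm_eq_norm, fnorm, Real.sq_sqrt]
  rw [trace_transpose_mul_eq_sum]
  exact Finset.sum_nonneg fun _ _ => mul_self_nonneg _

/-- Cauchy–Schwarz for the Frobenius inner product. -/
lemma trace_transpose_mul_le {n p : ℕ} (A B : Matrix (Fin n) (Fin p) ℝ) :
    (Aᵀ * B).trace ≤ ‖A‖ * ‖B‖ := by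
  rw [← fnorm_eq_norm, ← fnorm_eq_norm, fnorm, fnorm]
  simp only [trace_transpose_mul_eq_sum]
  simpa only [pow_two] using Real.sum_mul_le_sqrt_mul_sqrt Finset.univ
    (fun x : Fin n × Fin p => A x.1 x.2) (fun x => B x.1 x.2)

lemma norm_mul_transpose_sq_le {m n p : ℕ} {ε : ℝ} {X : Matrix (Fin n) (Fin p) ℝ}
    (hX : ‖Xᵀ * X - 1‖ ≤ ε) (W : Matrix (Fin m) (Fin p) ℝ) :
    ‖W * Xᵀ‖ ^ 2 ≤ (1 + ε) * ‖W‖ ^ 2 := by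
  have key : ‖W * Xᵀ‖ ^ 2 = ‖W‖ ^ 2 + ((Wᵀ * W)ᵀ * (Xᵀ * X - 1)).trace := by
    rw [← trace_transpose_mul_self, ← trace_transpose_mul_self, Matrix.mul_sub, Matrix.trace_sub,
      Matrix.mul_one, Matrix.trace_transpose, Matrix.transpose_mul, Matrix.transpose_transpose,
      Matrix.mul_assoc, Matrix.trace_mul_comm, Matrix.transpose_mul, Matrix.transpose_transpose]
    simp only [Matrix.mul_assoc]
    ring
  have hW : ‖Wᵀ * W‖ ≤ ‖W‖ ^ 2 := by
    simpa [pow_two, Matrix.frobenius_norm_transpose] using Matrix.frobenius_norm_mul Wᵀ W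
  have h := (trace_transpose_mul_le (Wᵀ * W) (Xᵀ * X - 1)).trans
    (mul_le_mul hW hX (norm_nonneg _) (sq_nonneg _))
  linarith

lemma norm_mul_sq_le {m n p : ℕ} {ε : ℝ} {X : Matrix (Fin n) (Fin p) ℝ}
    (hX : ‖Xᵀ * X - 1‖ ≤ ε) (M : Matrix (Fin m) (Fin n) ℝ) :
    ‖M * X‖ ^ 2 ≤ (1 + ε) * ‖M‖ ^ 2 := by
  have h₁ : ‖M * X‖ ^ 2 ≤ ‖M‖ * ‖M * X * Xᵀ‖ := by
    refine le_of_eq_of_le ?_ (trace_transpose_mul_le M (M * X * Xᵀ))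
    rw [← trace_transpose_mul_self, Matrix.transpose_mul, Matrix.mul_assoc,
      Matrix.trace_mul_comm, Matrix.mul_assoc, Matrix.mul_assoc]
  have h₂ := norm_mul_transpose_sq_le hX (M * X)
  have hε : 0 ≤ ε := (norm_nonneg _).trans hX
  rcases (sq_nonneg ‖M * X‖).eq_or_lt with h | h
  · rw [← h]
    positivity
  · refine le_of_mul_le_mul_right ?_ h
    calc ‖M * X‖ ^ 2 * ‖M * X‖ ^ 2 ≤ (‖M‖ * ‖M * X * Xᵀ‖) * (‖M‖ * ‖M * X * Xᵀ‖) :=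
          mul_self_le_mul_self (sq_nonneg _) h₁
      _ = ‖M‖ ^ 2 * ‖M * X * Xᵀ‖ ^ 2 := by ring
      _ ≤ ‖M‖ ^ 2 * ((1 + ε) * ‖M * X‖ ^ 2) := by gcongr
      _ = (1 + ε) * ‖M‖ ^ 2 * ‖M * X‖ ^ 2 := by ring

lemma norm_skewPart_le {m : ℕ} (M : Matrix (Fin m) (Fin m) ℝ) : ‖skewPart M‖ ≤ ‖M‖ := by
  have h := norm_sub_le M Mᵀ
  rw [Matrix.frobenius_norm_transpose] at h
  rw [skewPart, norm_smul, Real.norm_of_nonneg (by norm_num)]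
  linarith

lemma fnorm_skewPart_mul_le {n p : ℕ} {ε : ℝ} {X : Matrix (Fin n) (Fin p) ℝ}
    (hX : fnorm (Xᵀ * X - 1) ≤ ε) (g : Matrix (Fin n) (Fin p) ℝ) :
    fnorm (skewPart (g * Xᵀ) * X) ≤ (1 + ε) * fnorm g := by
  simp only [fnorm_eq_norm] at hX ⊢
  have hε : 0 ≤ ε := (norm_nonneg _).trans hX
  refine abs_le_of_sq_le_sq' ?_ (by positivity) |>.2
  calc ‖skewPart (g * Xᵀ) * X‖ ^ 2 ≤ (1 + ε) * ‖skewPart (g * Xᵀ)‖ ^ 2 := norm_mul_sq_le hX _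
    _ ≤ (1 + ε) * ‖g * Xᵀ‖ ^ 2 := by
        gcongr
        exact norm_skewPart_le _
    _ ≤ (1 + ε) * ((1 + ε) * ‖g‖ ^ 2) := by
        gcongr
        exact norm_mul_transpose_sq_le hX g
    _ = ((1 + ε) * ‖g‖) ^ 2 := by ring

end Frobenius

/-- for `X` in the safe region, `‖skew(g Xᵀ) X‖_F ≤ (1+ε) ‖g‖_F`. -/
theorem skew_grad_bound {n p : ℕ} (ε : ℝ) (hε : ε ∈ Set.Ioo (0 : ℝ) (3 / 4))
    (X : Matrix (Fin n) (Fin p) ℝ) (hX : fnorm (Xᵀ * X - 1) ≤ ε) :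
    ∀ g : Matrix (Fin n) (Fin p) ℝ, fnorm (skewPart (g * Xᵀ) * X) ≤ (1 + ε) * fnorm g := by
  exact fnorm_skewPart_mul_le hX
end
end

section
/- (Unconstrained deterministic optimization with vanilla gradient compression) Let f : ℝ^d → ℝ be differentiable with L-Lipschitz gradient (L > 0) and bounded below by f*. Let α ∈ (0,1] and let C : ℝ^d → ℝ^d satisfy ‖C(x) − x‖² ≤ (1−α)‖x‖² for all x ∈ ℝ^d. Fix a step size 0 < γ ≤ 1/L, an initial point x⁰ ∈ ℝ^d, and define iterates x^{k+1} := x^k − γ·C(∇f(x^k)) for k ≥ 0. Then for every K ≥ 1, (1/K)·Σ_{k=0}^{K−1} ‖∇f(x^k)‖² ≤ 2(f(x⁰) − f*) / (γαK). -/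
open Matrix Finset

noncomputable section

/-- Descent lemma: the quadratic upper bound for a function with `L`-Lipschitz gradient. -/
theorem descent_of_lipschitz_gradient {E : Type*} [NormedAddCommGroup E] [InnerProductSpace ℝ E]
    [CompleteSpace E] {f : E → ℝ} {g : E → E} {L : ℝ}
    (hgrad : ∀ x, HasGradientAt f (g x) x)
    (hlip : ∀ x y, ‖g x - g y‖ ≤ L * ‖x - y‖) (x v : E) :
    f (x + v) ≤ f x + inner ℝ (g x) v + L / 2 * ‖v‖ ^ 2 := by
  have hf : ∀ t : ℝ, HasDerivAt (fun t : ℝ => f (x + t • v)) (inner ℝ (g (x + t • v)) v) t := by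
    intro t
    have hline : HasDerivAt (fun t : ℝ => x + t • v) v t := by
      simpa using ((hasDerivAt_id t).smul_const v).const_add x
    simpa [Function.comp_def] using
      (hgrad (x + t • v)).hasFDerivAt.comp_hasDerivAt t hline
  have hB : ∀ t : ℝ, HasDerivAt
      (fun t : ℝ => f x + t * inner ℝ (g x) v + t ^ 2 * (L / 2 * ‖v‖ ^ 2))
      (inner ℝ (g x) v + 2 * t * (L / 2 * ‖v‖ ^ 2)) t := by
    intro t
    simpa using (((hasDerivAt_id t).mul_const (inner ℝ (g x) v)).const_add (f x)).fun_add
      (((hasDerivAt_id t).fun_pow 2).mul_const (L / 2 * ‖v‖ ^ 2))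
  have hbound : ∀ t ∈ Set.Ico (0 : ℝ) 1,
      inner ℝ (g (x + t • v)) v ≤ inner ℝ (g x) v + 2 * t * (L / 2 * ‖v‖ ^ 2) := by
    intro t ht
    have hcs : inner ℝ (g (x + t • v) - g x) v ≤ ‖g (x + t • v) - g x‖ * ‖v‖ :=
      real_inner_le_norm _ _
    have hg : ‖g (x + t • v) - g x‖ ≤ L * (t * ‖v‖) := by
      simpa [norm_smul, abs_of_nonneg ht.1] using hlip (x + t • v) x
    have hmul := mul_le_mul_of_nonneg_right hg (norm_nonneg v)
    rw [inner_sub_left] at hcs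
    linarith
  have h := image_le_of_deriv_right_le_deriv_boundary
    (fun t _ => (hf t).continuousAt.continuousWithinAt)
    (fun t _ => (hf t).hasDerivWithinAt) (by simp)
    (fun t _ => (hB t).continuousAt.continuousWithinAt)
    (fun t _ => (hB t).hasDerivWithinAt) hbound (Set.right_mem_Icc.2 zero_le_one)
  simpa using h

/-- One step of gradient descent along a direction `c` whose relative squared error with respect
to the gradient is at most `1 - α`. -/
theorem compressed_gradient_step_le {E : Type*} [NormedAddCommGroup E] [InnerProductSpace ℝ E]
    [CompleteSpace E] {f : E → ℝ} {g : E → E} {L α γ : ℝ}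
    (hgrad : ∀ x, HasGradientAt f (g x) x)
    (hlip : ∀ x y, ‖g x - g y‖ ≤ L * ‖x - y‖) (hγ0 : 0 ≤ γ) (hγ : γ * L ≤ 1) (x c : E)
    (hc : ‖c - g x‖ ^ 2 ≤ (1 - α) * ‖g x‖ ^ 2) :
    f (x - γ • c) ≤ f x - γ * α / 2 * ‖g x‖ ^ 2 := by
  have h := descent_of_lipschitz_gradient hgrad hlip x (-(γ • c))
  rw [← sub_eq_add_neg, inner_neg_right, real_inner_smul_right, norm_neg, norm_smul, mul_pow,
    Real.norm_eq_abs, sq_abs] at h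
  rw [norm_sub_sq_real, real_inner_comm] at hc
  have hquad : γ / 2 * (γ * L) * ‖c‖ ^ 2 ≤ γ / 2 * 1 * ‖c‖ ^ 2 := by gcongr
  have hcγ := mul_le_mul_of_nonneg_left hc (div_nonneg hγ0 zero_le_two)
  linarith

/-- unconstrained deterministic optimization with vanilla gradient
compression, single node. -/
theorem compressed_gd_unconstrained {d : ℕ} (L α γ fstar : ℝ)
    (hL : 0 < L) (hα : α ∈ Set.Ioc (0 : ℝ) 1)
    (f : EuclideanSpace ℝ (Fin d) → ℝ)
    (gradf : EuclideanSpace ℝ (Fin d) → EuclideanSpace ℝ (Fin d))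
    (hgrad : ∀ x, HasGradientAt f (gradf x) x)
    (hlip : ∀ x y, ‖gradf x - gradf y‖ ≤ L * ‖x - y‖)
    (hlb : ∀ x, fstar ≤ f x)
    (C : EuclideanSpace ℝ (Fin d) → EuclideanSpace ℝ (Fin d))
    (hC : ∀ x, ‖C x - x‖ ^ 2 ≤ (1 - α) * ‖x‖ ^ 2)
    (hγ0 : 0 < γ) (hγ : γ ≤ 1 / L)
    (x : ℕ → EuclideanSpace ℝ (Fin d)) (x0 : EuclideanSpace ℝ (Fin d)) (hx0 : x 0 = x0)
    (hrec : ∀ k, x (k + 1) = x k - γ • C (gradf (x k))) :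
    ∀ K : ℕ, 1 ≤ K →
      (1 / (K : ℝ)) * ∑ k ∈ Finset.range K, ‖gradf (x k)‖ ^ 2 ≤
        2 * (f x0 - fstar) / (γ * α * (K : ℝ)) := by
  intro K hK
  obtain ⟨hα0, -⟩ := hα
  have hγL : γ * L ≤ 1 := (le_div_iff₀ hL).1 hγ
  have hsum : ∀ n, γ * α / 2 * ∑ k ∈ Finset.range n, ‖gradf (x k)‖ ^ 2 ≤ f x0 - f (x n) := by
    intro n
    induction n with
    | zero => simp [hx0]
    | succ n ih =>
      have hstep := compressed_gradient_step_le hgrad hlip hγ0.le hγL (x n) _ (hC (gradf (x n)))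
      rw [← hrec] at hstep
      rw [Finset.sum_range_succ, mul_add]
      linarith
  have hK0 : (0 : ℝ) < K := by exact_mod_cast hK
  rw [one_div_mul_eq_div, mul_comm (γ * α), ← div_div, div_right_comm,
    div_le_div_iff_of_pos_right hK0, le_div_iff₀ (by positivity)]
  linarith [hsum K, hlb (x K)]
end
end
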